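/- arXiv:1410.7206 — 3 statements merged into one kernel-verified Lean document; each statement's English description precedes it below -/
import Mathlib

section
/- Let μ > 0 and c > 0, and set a₁ := −sqrt(μ/c). Then (1/(2π a₁))·∫_ℝ exp(iu a₁ c − u²c/2)·(1 + iu/a₁)^{−(1+μ)} du = −e^{−μ/2}·(μ/2)^{μ/2}/(2Γ(1+μ/2)), where (1+iu/a₁)^{−(1+μ)} denotes the principal branch of the complex power (well defined since Re(1+iu/a₁) = 1 > 0). -/
open Real Filter MeasureTheory

noncomputable section

/-- The Laplace transform of `t ^ q` on the open right half-plane. -/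
theorem integral_rpow_mul_cexp_neg_mul_Ioi {q : ℝ} (hq : -1 < q) {z : ℂ} (hz : 0 < z.re) :
    ∫ t in Set.Ioi (0 : ℝ), ((t ^ q : ℝ) : ℂ) * Complex.exp (-(z * t))
      = z ^ (-(1 + (q : ℂ))) * (Real.Gamma (1 + q) : ℂ) := by
  let f : ℝ → ENNReal := fun t => ENNReal.ofReal (t ^ q)
  have hf : Measurable f := by fun_prop
  have hft : ∀ᵐ t ∂(volume.restrict (Set.Ioi (0 : ℝ))), f t < ⊤ := by simp [f]
  let ν : Measure ℝ := (volume.restrict (Set.Ioi 0)).withDensity f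
  have hexp : Set.Iio 0 ⊆ ProbabilityTheory.integrableExpSet id ν := by
    intro s hs
    refine (integrable_withDensity_iff_integrable_smul' hf hft).2 ?_
    have h := integrableOn_rpow_mul_exp_neg_mul_rpow hq one_pos (neg_pos.2 hs)
    refine IntegrableOn.congr_fun h (fun t ht => ?_) measurableSet_Ioi
    have ht' : (0 : ℝ) ≤ t ^ q := rpow_nonneg (le_of_lt ht) _
    simp [f, ENNReal.toReal_ofReal ht']
  have hmgf (w : ℂ) : ProbabilityTheory.complexMGF id ν w
      = ∫ t in Set.Ioi (0 : ℝ), ((t ^ q : ℝ) : ℂ) * Complex.exp (w * t) := by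
    rw [ProbabilityTheory.complexMGF, integral_withDensity_eq_integral_toReal_smul hf hft]
    refine setIntegral_congr_fun measurableSet_Ioi (fun t ht => ?_)
    have ht' : (0 : ℝ) ≤ t ^ q := rpow_nonneg (le_of_lt ht) _
    simp only [f, ENNReal.toReal_ofReal ht', Complex.real_smul, id]
  have hL : AnalyticOnNhd ℂ (ProbabilityTheory.complexMGF id ν) {w | w.re < 0} := by
    intro w hw
    refine ProbabilityTheory.analyticAt_complexMGF ?_
    exact interior_mono hexp (by simpa using hw)
  have hR : AnalyticOnNhd ℂ
      (fun w : ℂ => (-w) ^ (-(1 + (q : ℂ))) * (Real.Gamma (1 + q) : ℂ)) {w | w.re < 0} := by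
    refine DifferentiableOn.analyticOnNhd (fun w hw => ?_) (Complex.isOpen_re_lt 0)
    have hs : -w ∈ Complex.slitPlane := Or.inl (by simpa using hw)
    exact ((differentiableAt_id.neg.cpow_const hs).mul_const _).differentiableWithinAt
  have heq : Set.EqOn (ProbabilityTheory.complexMGF id ν)
      (fun w : ℂ => (-w) ^ (-(1 + (q : ℂ))) * (Real.Gamma (1 + q) : ℂ)) {w | w.re < 0} := by
    refine hL.eqOn_of_preconnected_of_frequently_eq hR
      (convex_halfSpace_re_lt 0).isPreconnected (z₀ := ((-1 : ℝ) : ℂ)) (by simp) ?_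
    have h_real : ∃ᶠ x : ℝ in nhdsWithin (-1) {-1}ᶜ, ProbabilityTheory.complexMGF id ν x
        = (-(x : ℂ)) ^ (-(1 + (q : ℂ))) * (Real.Gamma (1 + q) : ℂ) := by
      refine Eventually.frequently ?_
      filter_upwards [nhdsWithin_le_nhds (Iio_mem_nhds (show (-1 : ℝ) < 0 by norm_num))] with x hx
      have hx' : 0 < -x := neg_pos.2 hx
      have h := Real.integral_rpow_mul_exp_neg_mul_Ioi (show 0 < 1 + q by linarith) hx'
      rw [one_div, inv_rpow hx'.le, ← rpow_neg hx'.le, add_sub_cancel_left] at h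
      rw [hmgf, ← Complex.ofReal_neg, ← Complex.ofReal_one, ← Complex.ofReal_add,
        ← Complex.ofReal_neg (1 + q), ← Complex.ofReal_cpow hx'.le, ← Complex.ofReal_mul, ← h,
        ← integral_complex_ofReal]
      simp
    have hcast : Tendsto (fun x : ℝ => (x : ℂ)) (nhdsWithin (-1) {-1}ᶜ)
        (nhdsWithin ((-1 : ℝ) : ℂ) {((-1 : ℝ) : ℂ)}ᶜ) := by
      refine Complex.continuous_ofReal.continuousWithinAt.tendsto_nhdsWithin (fun x hx => ?_)
      simpa only [Set.mem_compl_iff, Set.mem_singleton_iff, Complex.ofReal_inj] using hx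
    exact hcast.frequently h_real
  have h := heq (show -z ∈ {w : ℂ | w.re < 0} by simpa using hz)
  simpa [hmgf] using h

/-- The half-line Gaussian moment, in the form given by the duplication formula. -/
theorem integral_rpow_mul_exp_neg_inv_mul_sq {μ : ℝ} (hμ : 0 < μ) :
    √(2 * π / μ) * ∫ t in Set.Ioi (0 : ℝ), t ^ μ * rexp (-(1 / (2 * μ)) * t ^ 2)
      = π * (μ / 2) ^ (μ / 2) / Real.Gamma (1 + μ / 2) * Real.Gamma (1 + μ) := by
  have h := integral_rpow_mul_exp_neg_mul_rpow (p := 2) two_pos (show -1 < μ by linarith)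
    (show 0 < 1 / (2 * μ) by positivity)
  simp only [rpow_two] at h
  have hd := Real.Gamma_mul_Gamma_add_half ((μ + 1) / 2)
  rw [show (μ + 1) / 2 + 1 / 2 = 1 + μ / 2 by ring, show 2 * ((μ + 1) / 2) = 1 + μ by ring,
    show 1 - (1 + μ) = -μ by ring] at hd
  have hG : 0 < Real.Gamma (1 + μ / 2) := Real.Gamma_pos_of_pos (by positivity)
  rw [h, div_mul_eq_mul_div, eq_div_iff hG.ne']
  have e1 : (1 / (2 * μ)) ^ (-(μ + 1) / 2) = √2 * √μ * (2 ^ (μ / 2) * μ ^ (μ / 2)) := by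
    rw [one_div, inv_rpow (by positivity), ← rpow_neg (by positivity),
      show -(-(μ + 1) / 2) = 1 / 2 + μ / 2 by ring, rpow_add (by positivity),
      mul_rpow (by positivity) hμ.le, mul_rpow (by positivity) hμ.le, ← sqrt_eq_rpow,
      ← sqrt_eq_rpow]
  have e2 : (2 : ℝ) ^ (-μ) = (2 ^ (μ / 2))⁻¹ * (2 ^ (μ / 2))⁻¹ := by
    rw [← rpow_neg two_pos.le, ← rpow_add two_pos]
    ring_nf
  have e3 : √(2 * π / μ) = √2 * √π / √μ := by
    rw [sqrt_div (by positivity), sqrt_mul (by positivity)]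
  rw [e1, e3, div_rpow hμ.le two_pos.le]
  calc _ = √2 * √π / √μ * (√2 * √μ * (2 ^ (μ / 2) * μ ^ (μ / 2))) * (1 / 2)
        * (Real.Gamma ((μ + 1) / 2) * Real.Gamma (1 + μ / 2)) := by ring
    _ = (√2 * √2) * (√π * √π) * (1 / 2) * ((√μ)⁻¹ * √μ)
        * (2 ^ (μ / 2) * (2 ^ (μ / 2))⁻¹) * (μ ^ (μ / 2) * (2 ^ (μ / 2))⁻¹)
        * Real.Gamma (1 + μ) := by rw [hd, e2]; ring
    _ = _ := by
      rw [mul_self_sqrt two_pos.le, mul_self_sqrt pi_pos.le,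
        inv_mul_cancel₀ (sqrt_pos.2 hμ).ne', mul_inv_cancel₀ (by positivity)]
      ring

theorem integrable_gamma_gaussian_kernel {μ : ℝ} (hμ : 0 < μ) :
    Integrable (Function.uncurry fun v t : ℝ =>
      Complex.exp (Complex.I * v * μ - (v : ℂ) ^ 2 * μ / 2)
        * (((t ^ μ : ℝ) : ℂ) * Complex.exp (-((1 + Complex.I * v) * t))))
      (volume.prod (volume.restrict (Set.Ioi 0))) := by
  have h1 : Integrable (fun v : ℝ => rexp (-(μ / 2) * v ^ 2)) :=
    integrable_exp_neg_mul_sq (by positivity)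
  have h2 : Integrable (fun t : ℝ => t ^ μ * rexp (-1 * t ^ (1 : ℝ)))
      (volume.restrict (Set.Ioi 0)) :=
    integrableOn_rpow_mul_exp_neg_mul_rpow (by linarith) one_pos one_pos
  refine (h1.mul_prod h2).mono ?_ (ae_of_all _ fun ⟨v, t⟩ => le_of_eq ?_)
  · refine Measurable.aestronglyMeasurable ?_
    unfold Function.uncurry
    fun_prop
  · simp only [Function.uncurry, norm_mul, Complex.norm_exp, Complex.norm_real, norm_eq_abs,
      abs_exp]
    have e1 : (Complex.I * v * μ - (v : ℂ) ^ 2 * μ / 2).re = -(μ / 2) * v ^ 2 := by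
      rw [show Complex.I * v * μ - (v : ℂ) ^ 2 * μ / 2
        = ((-(μ / 2) * v ^ 2 : ℝ) : ℂ) + ((v * μ : ℝ) : ℂ) * Complex.I by push_cast; ring,
        Complex.add_re, Complex.ofReal_re, Complex.re_ofReal_mul, Complex.I_re, mul_zero, add_zero]
    rw [e1]
    simp

theorem integral_cexp_mul_one_add_I_mul_cpow {μ : ℝ} (hμ : 0 < μ) :
    ∫ v : ℝ, Complex.exp (Complex.I * v * μ - (v : ℂ) ^ 2 * μ / 2)
        * (1 + Complex.I * v) ^ (-(1 + (μ : ℂ)))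
      = ((π * rexp (-μ / 2) * (μ / 2) ^ (μ / 2) / Real.Gamma (1 + μ / 2) : ℝ) : ℂ) := by
  have hG : (Real.Gamma (1 + μ) : ℂ) ≠ 0 :=
    Complex.ofReal_ne_zero.2 (Real.Gamma_pos_of_pos (by positivity)).ne'
  have hμ' : (μ : ℂ) ≠ 0 := Complex.ofReal_ne_zero.2 hμ.ne'
  refine mul_right_cancel₀ hG ?_
  have inner (t : ℝ) : ∫ v : ℝ, Complex.exp (Complex.I * v * μ - (v : ℂ) ^ 2 * μ / 2)
        * (((t ^ μ : ℝ) : ℂ) * Complex.exp (-((1 + Complex.I * v) * t)))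
      = ((√(2 * π / μ) * rexp (-μ / 2) * (t ^ μ * rexp (-(1 / (2 * μ)) * t ^ 2)) : ℝ) : ℂ) := by
    have hb : 0 < ((μ / 2 : ℝ) : ℂ).re := by simpa using hμ
    have h := fourierIntegral_gaussian hb ((μ - t : ℝ) : ℂ)
    have hs : ((π : ℂ) / ((μ / 2 : ℝ) : ℂ)) ^ (1 / 2 : ℂ) = (√(2 * π / μ) : ℂ) := by
      rw [sqrt_eq_rpow, Complex.ofReal_cpow (by positivity)]
      congr 1
      · push_cast; field_simp
      · norm_num
    calc _ = ∫ v : ℝ, (((t ^ μ : ℝ) : ℂ) * Complex.exp (-t))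
          * (Complex.exp (Complex.I * ((μ - t : ℝ) : ℂ) * v)
            * Complex.exp (-((μ / 2 : ℝ) : ℂ) * (v : ℂ) ^ 2)) := by
          congr 1 with v
          rw [mul_left_comm, mul_assoc _ (Complex.exp (-(t : ℂ))), ← Complex.exp_add,
            ← Complex.exp_add, ← Complex.exp_add]
          congr 2
          push_cast
          ring
      _ = _ := by
          have he : Complex.exp (-t)
                * Complex.exp (-((μ - t : ℝ) : ℂ) ^ 2 / (4 * ((μ / 2 : ℝ) : ℂ)))
              = Complex.exp (-μ / 2) * Complex.exp (-(1 / (2 * μ)) * t ^ 2) := by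
            rw [← Complex.exp_add, ← Complex.exp_add]
            congr 1
            push_cast
            field_simp
            ring
          rw [integral_const_mul, h, hs]
          simp only [Complex.ofReal_mul, Complex.ofReal_exp, Complex.ofReal_neg,
            Complex.ofReal_div, Complex.ofReal_pow, Complex.ofReal_one, Complex.ofReal_ofNat] at he ⊢
          linear_combination ((t ^ μ : ℝ) : ℂ) * (√(2 * π / μ) : ℂ) * he
  calc _ = ∫ v : ℝ, ∫ t in Set.Ioi (0 : ℝ),
        Complex.exp (Complex.I * v * μ - (v : ℂ) ^ 2 * μ / 2)
        * (((t ^ μ : ℝ) : ℂ) * Complex.exp (-((1 + Complex.I * v) * t))) := by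
        rw [← integral_mul_const]
        congr 1 with v
        rw [integral_const_mul, integral_rpow_mul_cexp_neg_mul_Ioi (by linarith) (by simp),
          mul_assoc]
    _ = _ := by
        rw [integral_integral_swap (integrable_gamma_gaussian_kernel hμ)]
        simp_rw [inner]
        rw [integral_complex_ofReal, integral_const_mul, mul_right_comm,
          integral_rpow_mul_exp_neg_inv_mul_sq hμ]
        push_cast
        ring

theorem stmt16 (μ c : ℝ) (hμ : 0 < μ) (hc : 0 < c)
    (a₁ : ℝ) (ha₁ : a₁ = -Real.sqrt (μ/c)) :
    ((1/(2*Real.pi*a₁) : ℝ) : ℂ)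
        * ∫ u : ℝ, Complex.exp (Complex.I*(u:ℂ)*(a₁:ℂ)*(c:ℂ) - (u:ℂ)^2*(c:ℂ)/2)
            * (1 + Complex.I*(u:ℂ)/(a₁:ℂ)) ^ (-(1 + (μ:ℂ)))
      = ((-(Real.exp (-μ/2) * (μ/2) ^ (μ/2) / (2*Real.Gamma (1 + μ/2))) : ℝ) : ℂ) := by
  have hneg : a₁ < 0 := by rw [ha₁]; exact neg_neg_of_pos (sqrt_pos.2 (by positivity))
  have hsq : a₁ ^ 2 * c = μ := by
    rw [ha₁, neg_sq, sq_sqrt (by positivity), div_mul_cancel₀ _ hc.ne']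
  have hsq' : (a₁ : ℂ) ^ 2 * c = μ := by exact_mod_cast hsq
  have ha : (a₁ : ℂ) ≠ 0 := Complex.ofReal_ne_zero.2 hneg.ne
  have h := Measure.integral_comp_mul_left (fun u : ℝ =>
    Complex.exp (Complex.I*(u:ℂ)*(a₁:ℂ)*(c:ℂ) - (u:ℂ)^2*(c:ℂ)/2)
            * (1 + Complex.I*(u:ℂ)/(a₁:ℂ)) ^ (-(1 + (μ:ℂ)))) a₁
  have hsubst : (∫ v : ℝ, Complex.exp (Complex.I * ((a₁ * v : ℝ) : ℂ) * a₁ * c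
        - ((a₁ * v : ℝ) : ℂ) ^ 2 * c / 2)
        * (1 + Complex.I * ((a₁ * v : ℝ) : ℂ) / a₁) ^ (-(1 + (μ : ℂ))))
      = ∫ v : ℝ, Complex.exp (Complex.I * v * μ - (v : ℂ) ^ 2 * μ / 2)
        * (1 + Complex.I * v) ^ (-(1 + (μ : ℂ))) := by
    congr 1 with v
    congr 2
    · rw [← hsq']; push_cast; ring
    · push_cast; field_simp
  rw [hsubst, integral_cexp_mul_one_add_I_mul_cpow hμ, abs_of_neg (inv_lt_zero.2 hneg),
    Complex.real_smul] at h
  have hcoef : ((1 / (2 * π * a₁) : ℝ) : ℂ) = -(1 / (2 * π)) * ((-a₁⁻¹ : ℝ) : ℂ) := by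
    push_cast
    field_simp
  rw [hcoef, mul_assoc, ← h]
  have hG : (Real.Gamma (1 + μ / 2) : ℂ) ≠ 0 :=
    Complex.ofReal_ne_zero.2 (Real.Gamma_pos_of_pos (by positivity)).ne'
  have hpi : (π : ℂ) ≠ 0 := Complex.ofReal_ne_zero.2 pi_ne_zero
  push_cast
  field_simp

end
end

section
/- Extend V to complex arguments by Vc(w) := (μ/2)(κ − ρξw − ((κ−ρξw)² + w(1−w)ξ²)^{1/2}), using the principal branch of the complex square root. Then for every a ∈ (u_−, u_+), the map z ↦ Re Vc(a + iz) on ℝ has a unique maximum at z = 0; that is, Re Vc(a + iz) < Vc(a) = V(a) for all real z ≠ 0. -/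
open Real Set Filter Asymptotics

noncomputable section

namespace Heston

def dd (κ ξ ρ u : ℝ) : ℝ := Real.sqrt ((κ - ρ*ξ*u)^2 + u*(1-u)*ξ^2)

def mu (κ θ ξ : ℝ) : ℝ := 2*κ*θ/ξ^2

def VV (κ θ ξ ρ u : ℝ) : ℝ := mu κ θ ξ / 2 * (κ - ρ*ξ*u - dd κ ξ ρ u)

def gam (κ ξ ρ u : ℝ) : ℝ := (κ - ρ*ξ*u - dd κ ξ ρ u) / (κ - ρ*ξ*u + dd κ ξ ρ u)

def bet (κ ξ t : ℝ) : ℝ := ξ^2/(4*κ) * (1 - Real.exp (-(κ*t)))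

def HH (κ θ ξ ρ v t u : ℝ) : ℝ :=
  VV κ θ ξ ρ u * v * Real.exp (-(κ*t)) / (κ*θ - 2 * bet κ ξ t * VV κ θ ξ ρ u)
  - mu κ θ ξ * Real.log ((κ*θ - 2 * bet κ ξ t * VV κ θ ξ ρ u) / (κ*θ*(1 - gam κ ξ ρ u)))

def eta (κ ξ ρ : ℝ) : ℝ := Real.sqrt (ξ^2*(1-ρ^2) + (2*κ - ρ*ξ)^2)

def uplus (κ ξ ρ : ℝ) : ℝ := (ξ - 2*κ*ρ + eta κ ξ ρ) / (2*ξ*(1-ρ^2))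

def uminus (κ ξ ρ : ℝ) : ℝ := (ξ - 2*κ*ρ - eta κ ξ ρ) / (2*ξ*(1-ρ^2))

def psi (κ ξ ρ t : ℝ) : ℝ := ξ*(Real.exp (κ*t) - 1) - 4*κ*ρ*Real.exp (κ*t)

def nuu (κ ξ ρ t : ℝ) : ℝ := Real.sqrt ((psi κ ξ ρ t)^2 - 16*κ^2*Real.exp (κ*t))

def ustarplus (κ ξ ρ t : ℝ) : ℝ := (psi κ ξ ρ t + nuu κ ξ ρ t) / (2*ξ*(Real.exp (κ*t) - 1))

def ustarminus (κ ξ ρ t : ℝ) : ℝ := (psi κ ξ ρ t - nuu κ ξ ρ t) / (2*ξ*(Real.exp (κ*t) - 1))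

def rhoplus (κ ξ t : ℝ) : ℝ :=
  Real.exp (-(2*κ*t)) * (ξ*(Real.exp (2*κ*t) - 1)
    + (Real.exp (κ*t) + 1) * Real.sqrt (16*κ^2*Real.exp (2*κ*t) + ξ^2*(1 - Real.exp (κ*t))^2)) / (8*κ)

def rhominus (κ ξ t : ℝ) : ℝ :=
  Real.exp (-(2*κ*t)) * (ξ*(Real.exp (2*κ*t) - 1)
    - (Real.exp (κ*t) + 1) * Real.sqrt (16*κ^2*Real.exp (2*κ*t) + ξ^2*(1 - Real.exp (κ*t))^2)) / (8*κ)

def R1 (κ ξ ρ t : ℝ) : Prop := rhominus κ ξ t ≤ ρ ∧ ρ ≤ min (rhoplus κ ξ t) (κ/ξ)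
def R2 (κ ξ ρ t : ℝ) : Prop := -1 < ρ ∧ ρ < rhominus κ ξ t
def R3a (κ ξ ρ t : ℝ) : Prop := rhoplus κ ξ t < ρ ∧ ρ < 1 ∧ ρ ≤ κ/ξ
def R3b (κ ξ ρ t : ℝ) : Prop := rhoplus κ ξ t < ρ ∧ ρ < 1 ∧ κ/ξ < ρ
def R4 (κ ξ ρ t : ℝ) : Prop := κ/ξ < ρ ∧ ρ ≤ min (rhoplus κ ξ t) 1

def D1 (κ ξ ρ : ℝ) : Set ℝ := Set.Icc (uminus κ ξ ρ) (uplus κ ξ ρ)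
def D2 (κ ξ ρ t : ℝ) : Set ℝ := Set.Ico (uminus κ ξ ρ) (ustarplus κ ξ ρ t)
def D3a (κ ξ ρ t : ℝ) : Set ℝ := Set.Ioc (ustarminus κ ξ ρ t) (uplus κ ξ ρ)
def D3b (κ ξ ρ t : ℝ) : Set ℝ := Set.Ioc (ustarminus κ ξ ρ t) 1
def D4 (κ ξ ρ : ℝ) : Set ℝ := Set.Ioc (uminus κ ξ ρ) 1

def regimeD (κ ξ ρ t : ℝ) (D : Set ℝ) : Prop :=
  (R1 κ ξ ρ t ∧ D = D1 κ ξ ρ) ∨ (R2 κ ξ ρ t ∧ D = D2 κ ξ ρ t) ∨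
  (R3a κ ξ ρ t ∧ D = D3a κ ξ ρ t) ∨ (R3b κ ξ ρ t ∧ D = D3b κ ξ ρ t) ∨
  (R4 κ ξ ρ t ∧ D = D4 κ ξ ρ)

def Vstar (κ θ ξ ρ : ℝ) (D : Set ℝ) (k : ℝ) : ℝ :=
  sSup ((fun u => u*k - VV κ θ ξ ρ u) '' D)

def ZZ (κ θ ξ ρ k : ℝ) : ℝ :=
  if k < deriv (VV κ θ ξ ρ) 0 then -1
  else if k ≤ deriv (VV κ θ ξ ρ) 1 then 1
  else if κ ≤ ρ*ξ then 1 else -1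

def v0inf (κ θ ξ ρ : ℝ) (D : Set ℝ) (k : ℝ) : ℝ :=
  2*(2*Vstar κ θ ξ ρ D k - k
    + 2*ZZ κ θ ξ ρ k * Real.sqrt (Vstar κ θ ξ ρ D k * (Vstar κ θ ξ ρ D k - k)))

def Vc (κ θ ξ ρ : ℝ) (w : ℂ) : ℂ :=
  ((mu κ θ ξ : ℝ) : ℂ)/2 * ((κ:ℂ) - (ρ:ℂ)*(ξ:ℂ)*w
    - (((κ:ℂ) - (ρ:ℂ)*(ξ:ℂ)*w)^2 + w*(1-w)*(ξ:ℂ)^2) ^ ((1:ℂ)/2))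

/-- Between the critical points `uminus` and `uplus` the radicand of `dd` is positive. -/
theorem radicand_pos {κ ξ ρ a : ℝ} (hξ : 0 < ξ) (hρ₁ : -1 < ρ) (hρ₂ : ρ < 1)
    (ha : a ∈ Set.Ioo (uminus κ ξ ρ) (uplus κ ξ ρ)) :
    0 < (κ - ρ*ξ*a)^2 + a*(1-a)*ξ^2 := by
  have hc : 0 < 1 - ρ^2 := by nlinarith
  have hden : 0 < 2*ξ*(1-ρ^2) := by positivity
  obtain ⟨h₁, h₂⟩ := ha
  rw [uminus, div_lt_iff₀ hden] at h₁
  rw [uplus, lt_div_iff₀ hden] at h₂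
  have heta : eta κ ξ ρ ^ 2 = ξ^2*(1-ρ^2) + (2*κ - ρ*ξ)^2 := Real.sq_sqrt (by positivity)
  have hsq : 0 < 4*(1-ρ^2) * ((κ - ρ*ξ*a)^2 + a*(1-a)*ξ^2) := by
    have := mul_pos (sub_pos.2 h₁) (sub_pos.2 h₂)
    linear_combination this + heta
  exact pos_of_mul_pos_right hsq (by positivity)

/-- The real part of `Vc`, with the principal root expressed through the radicand. -/
theorem Vc_re (κ θ ξ ρ : ℝ) (w : ℂ) :
    (Vc κ θ ξ ρ w).re = mu κ θ ξ / 2 * (κ - ρ*ξ*w.re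
      - Real.sqrt ((‖((κ:ℂ) - (ρ:ℂ)*(ξ:ℂ)*w)^2 + w*(1-w)*(ξ:ℂ)^2‖
        + (((κ:ℂ) - (ρ:ℂ)*(ξ:ℂ)*w)^2 + w*(1-w)*(ξ:ℂ)^2).re) / 2)) := by
  have hmu : ((mu κ θ ξ : ℝ) : ℂ)/2 = ((mu κ θ ξ / 2 : ℝ) : ℂ) := by push_cast; rfl
  rw [Vc, hmu, Complex.re_ofReal_mul, Complex.sub_re, one_div, Complex.cpow_inv_two_re]
  simp

theorem stmt17 (κ θ ξ ρ : ℝ) (hκ : 0 < κ) (hθ : 0 < θ) (hξ : 0 < ξ)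
    (hρ₁ : -1 < ρ) (hρ₂ : ρ < 1) :
    ∀ a ∈ Set.Ioo (uminus κ ξ ρ) (uplus κ ξ ρ),
      (Vc κ θ ξ ρ (a:ℂ)).re = VV κ θ ξ ρ a ∧
      ∀ z : ℝ, z ≠ 0 → (Vc κ θ ξ ρ ((a:ℂ) + (z:ℂ)*Complex.I)).re < VV κ θ ξ ρ a := by
  intro a ha
  have hQ := radicand_pos hξ hρ₁ hρ₂ ha
  have hmu : 0 < mu κ θ ξ / 2 := by unfold mu; positivity
  refine ⟨?_, fun z hz => ?_⟩
  · have hcast : ((κ:ℂ) - (ρ:ℂ)*(ξ:ℂ)*a)^2 + a*(1-a)*(ξ:ℂ)^2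
        = (((κ - ρ*ξ*a)^2 + a*(1-a)*ξ^2 : ℝ) : ℂ) := by push_cast; rfl
    rw [Vc_re, hcast, Complex.norm_of_nonneg hQ.le, Complex.ofReal_re, Complex.ofReal_re,
      add_self_div_two, VV, dd]
  · rw [Vc_re, VV, dd]
    set w : ℂ := (a:ℂ) + (z:ℂ)*Complex.I with hw
    have hwre : w.re = a := by simp [hw]
    set R : ℂ := ((κ:ℂ) - (ρ:ℂ)*(ξ:ℂ)*w)^2 + w*(1-w)*(ξ:ℂ)^2 with hR
    have hRre : R.re = (κ - ρ*ξ*a)^2 + a*(1-a)*ξ^2 + (1-ρ^2)*ξ^2*z^2 := by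
      simp [hR, hw, pow_two]
      ring
    have hc : 0 < 1 - ρ^2 := by nlinarith
    have hgap : 0 < (1-ρ^2)*ξ^2*z^2 := by positivity
    have hnorm := Complex.re_le_norm R
    rw [hwre]
    refine mul_lt_mul_of_pos_left (sub_lt_sub_left ?_ _) hmu
    exact Real.sqrt_lt_sqrt hQ.le (by linarith)

end Heston
end
end

section
/- Let a > 0, b ∈ ℝ and k ∈ ℝ, and for τ large enough that a + b/τ > 0 set Σ_τ := sqrt(a + b/τ). Define the Black–Scholes call price C(τ) := N(d₊(τ)) − e^{kτ}N(d₋(τ)) with d±(τ) := −kτ/(Σ_τ√τ) ± Σ_τ√τ/2. Then as τ → ∞, C(τ) = I(k,τ,−a/2,a/2,0) + φ_BS(k,a,b)·τ^{−1/2}·e^{−τ(V*_BS(k,a)−k)}·(1 + O(τ^{−1})). -/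
open Real Filter MeasureTheory

noncomputable section

/-- The standard normal cumulative distribution function. -/
def Ncdf (x : ℝ) : ℝ := (Real.sqrt (2*Real.pi))⁻¹ * ∫ y in Set.Iic x, Real.exp (-(y^2/2))

/-- The function 𝓘 of the paper. -/
def II (k τ x y c : ℝ) : ℝ :=
  (if k < x then 1 - Real.exp (k*τ) else 0) + (if x < k ∧ k < y then 1 else 0)
  + (if y < k then c else 0) + (if k = y then (1-c)/2 else 0)
  + (if k = x then 1 - Real.exp (k*τ)/2 else 0)

def VstarBS (k a : ℝ) : ℝ := (k + a/2)^2 / (2*a)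

def phiBS (k a b : ℝ) : ℝ :=
  if k ≠ a/2 ∧ k ≠ -(a/2) then
    4*a ^ ((3:ℝ)/2) / ((4*k^2 - a^2)*Real.sqrt (2*Real.pi))
      * Real.exp (b*(k^2/(2*a^2) - 1/8))
  else (b - 2) / (2*Real.sqrt (2*a*Real.pi))

lemma integrable_exp_neg_sq_half : Integrable fun y : ℝ => Real.exp (-(y^2/2)) := by
  have h := integrable_exp_neg_mul_sq (b := 1/2) (by norm_num)
  refine h.congr (Eventually.of_forall fun y => ?_)
  simp only
  congr 1
  ring

lemma integral_exp_neg_sq_half : ∫ y : ℝ, Real.exp (-(y^2/2)) = Real.sqrt (2*Real.pi) := by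
  have h := integral_gaussian (1/2)
  have e : Real.pi / (1/2) = 2 * Real.pi := by ring
  rw [e] at h
  rw [← h]
  congr 1
  ext y
  congr 1
  ring

lemma Ncdf_neg_eq (x : ℝ) :
    Ncdf (-x) = (Real.sqrt (2*Real.pi))⁻¹ * ∫ y in Set.Ioi x, Real.exp (-(y^2/2)) := by
  have h := integral_comp_neg_Iic (-x) fun y : ℝ => Real.exp (-(y^2/2))
  simp only [neg_sq, neg_neg] at h
  rw [Ncdf, h]

lemma Ncdf_neg (x : ℝ) : Ncdf (-x) = 1 - Ncdf x := by
  have h := integral_add_compl (measurableSet_Iic (a := x)) integrable_exp_neg_sq_half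
  rw [Set.compl_Iic, integral_exp_neg_sq_half] at h
  have hc : Real.sqrt (2*Real.pi) ≠ 0 := by positivity
  rw [Ncdf_neg_eq, Ncdf, eq_sub_of_add_eq' h]
  field_simp

lemma Ncdf_zero : Ncdf 0 = 1/2 := by
  have h := Ncdf_neg 0
  rw [neg_zero] at h
  linarith

lemma tendsto_exp_neg_sq_half : Tendsto (fun y : ℝ => Real.exp (-(y^2/2))) atTop (nhds 0) := by
  refine Real.tendsto_exp_neg_atTop_nhds_zero.comp ?_
  exact (tendsto_pow_atTop two_ne_zero).atTop_div_const (by norm_num)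

/-- First-order Mills ratio bounds. -/
lemma mills_ratio_bound {x : ℝ} (hx : 0 < x) :
    |(∫ y in Set.Ioi x, Real.exp (-(y^2/2))) - Real.exp (-(x^2/2)) / x|
      ≤ Real.exp (-(x^2/2)) / x^3 := by
  set e : ℝ → ℝ := fun y => Real.exp (-(y^2/2)) with he
  have hd : ∀ y, HasDerivAt e (-(y * e y)) y := by
    intro y
    have h1 : HasDerivAt (fun y : ℝ => -(y^2/2)) (-y) y := by
      have := ((hasDerivAt_pow 2 y).div_const 2).neg
      convert! this using 1
      simp
    convert! h1.exp using 1
    simp only [he]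
    ring
  have hdq : ∀ y ∈ Set.Ici x, HasDerivAt (fun y => e y / y) (-((1 + 1/y^2) * e y)) y := by
    intro y hy
    have hy0 : y ≠ 0 := (hx.trans_le hy).ne'
    convert! (hd y).div (hasDerivAt_id y) hy0 using 1
    simp only [id]
    field_simp
    ring
  have hlim : Tendsto (fun y => e y / y) atTop (nhds 0) := by
    have := tendsto_exp_neg_sq_half.mul tendsto_inv_atTop_zero
    rw [mul_zero] at this
    exact this.congr fun y => (div_eq_mul_inv _ _).symm
  have hpos : ∀ y, 0 < e y := fun y => Real.exp_pos _
  have hneg : ∀ y ∈ Set.Ioi x, -((1 + 1/y^2) * e y) ≤ 0 := by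
    intro y _
    have := hpos y
    have : 0 ≤ (1 + 1/y^2) * e y := by positivity
    linarith
  have hint := integrableOn_Ioi_deriv_of_nonpos' hdq hneg hlim
  have hval := integral_Ioi_of_hasDerivAt_of_nonpos' hdq hneg hlim
  rw [integral_neg] at hval
  have hi2 : IntegrableOn (fun y => (1 + 1/y^2) * e y) (Set.Ioi x) := by
    simpa using hint.neg
  have hi1 : IntegrableOn e (Set.Ioi x) := integrable_exp_neg_sq_half.integrableOn
  have hI : (∫ y in Set.Ioi x, (1 + 1/y^2) * e y) = e x / x := by linarith
  have hlow : (∫ y in Set.Ioi x, e y) ≤ e x / x := by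
    rw [← hI]
    refine setIntegral_mono_on hi1 hi2 measurableSet_Ioi fun y _ => ?_
    have h1 : 0 ≤ 1/y^2 := by positivity
    nlinarith [hpos y]
  have hup : e x / x ≤ (1 + 1/x^2) * ∫ y in Set.Ioi x, e y := by
    rw [← hI, ← integral_const_mul]
    refine setIntegral_mono_on hi2 (hi1.const_mul _) measurableSet_Ioi fun y hy => ?_
    have hy' : x ≤ y := le_of_lt hy
    have := hpos y
    gcongr
  have h3 : 1/x^2 * (∫ y in Set.Ioi x, e y) ≤ e x / x^3 := by
    calc 1/x^2 * (∫ y in Set.Ioi x, e y) ≤ 1/x^2 * (e x / x) := by gcongr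
      _ = e x / x^3 := by field_simp
  have h4 : 0 ≤ e x / x^3 := div_nonneg (hpos x).le (by positivity)
  rw [abs_le]
  constructor <;> linarith

/-- Tail expansion of the normal distribution function, on both sides of the origin. -/
lemma Ncdf_tail {x : ℝ} (hx : x ≠ 0) :
    |Ncdf x - (if 0 < x then 1 else 0)
        + (Real.sqrt (2*Real.pi))⁻¹ * Real.exp (-(x^2/2)) / x|
      ≤ (Real.sqrt (2*Real.pi))⁻¹ * Real.exp (-(x^2/2)) / |x|^3 := by
  have key : ∀ y : ℝ, 0 < y → |Ncdf (-y) - (Real.sqrt (2*Real.pi))⁻¹ * Real.exp (-(y^2/2)) / y|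
      ≤ (Real.sqrt (2*Real.pi))⁻¹ * Real.exp (-(y^2/2)) / y^3 := by
    intro y hy
    have hc : 0 ≤ (Real.sqrt (2*Real.pi))⁻¹ := by positivity
    rw [Ncdf_neg_eq, mul_div_assoc, mul_div_assoc, ← mul_sub, abs_mul, abs_of_nonneg hc]
    exact mul_le_mul_of_nonneg_left (mills_ratio_bound hy) hc
  rcases hx.lt_or_gt with h | h
  · have := key (-x) (by linarith)
    rw [neg_neg, neg_sq] at this
    rw [if_neg h.not_gt, abs_of_neg h]
    convert this using 2
    rw [div_neg]
    ring
  · have := key x h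
    rw [if_pos h, abs_of_pos h]
    rw [Ncdf_neg, ← abs_neg] at this
    convert this using 2
    ring

/-- Expansion of the normal distribution function at the origin. -/
lemma Ncdf_near_zero (x : ℝ) :
    |Ncdf x - 1/2 - (Real.sqrt (2*Real.pi))⁻¹ * x| ≤ (Real.sqrt (2*Real.pi))⁻¹ * |x|^3 := by
  have hc : 0 ≤ (Real.sqrt (2*Real.pi))⁻¹ := by positivity
  have hint := integrable_exp_neg_sq_half
  have hcont : Continuous fun y : ℝ => Real.exp (-(y^2/2)) := by fun_prop
  have h1 : Ncdf x - 1/2 - (Real.sqrt (2*Real.pi))⁻¹ * x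
      = (Real.sqrt (2*Real.pi))⁻¹ * ∫ y in (0:ℝ)..x, (Real.exp (-(y^2/2)) - 1) := by
    rw [intervalIntegral.integral_sub (hcont.intervalIntegrable _ _)
        intervalIntegrable_const, ← Ncdf_zero, Ncdf, Ncdf,
      ← intervalIntegral.integral_Iic_sub_Iic hint.integrableOn hint.integrableOn]
    simp
    ring
  rw [h1, abs_mul, abs_of_nonneg hc]
  refine mul_le_mul_of_nonneg_left ?_ hc
  have := intervalIntegral.norm_integral_le_of_norm_le_const (a := 0) (b := x) (C := |x|^2)
    (f := fun y : ℝ => Real.exp (-(y^2/2)) - 1) ?_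
  · rw [Real.norm_eq_abs, sub_zero] at this
    calc _ ≤ _ := this
      _ = |x|^3 := by ring
  · intro y hy
    have hy1 : |y| ≤ |x| := by
      have := Set.abs_sub_left_of_mem_uIcc (Set.uIoc_subset_uIcc hy)
      simpa using this
    have h2 : y^2 ≤ |x|^2 := by
      rw [← sq_abs y]; gcongr
    have h3 := Real.add_one_le_exp (-(y^2/2))
    have h4 : Real.exp (-(y^2/2)) ≤ 1 := Real.exp_le_one_iff.2 (by nlinarith [sq_nonneg y])
    rw [Real.norm_eq_abs, abs_le]
    constructor <;> nlinarith [sq_nonneg y]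

lemma rpow_neg_half_eq {τ : ℝ} (hτ : 0 < τ) : τ ^ (-(1:ℝ)/2) = (Real.sqrt τ)⁻¹ := by
  rw [neg_div, Real.rpow_neg hτ.le, Real.sqrt_eq_rpow]

lemma rpow_three_halves_eq {τ : ℝ} (hτ : 0 ≤ τ) : τ ^ ((3:ℝ)/2) = Real.sqrt τ ^ 3 := by
  rw [Real.sqrt_eq_rpow, ← Real.rpow_natCast, ← Real.rpow_mul hτ]
  norm_num

lemma rpow_neg_three_halves_eq {τ : ℝ} (hτ : 0 < τ) :
    τ ^ (-(3:ℝ)/2) = (Real.sqrt τ ^ 3)⁻¹ := by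
  rw [neg_div, Real.rpow_neg hτ.le, rpow_three_halves_eq hτ.le]

lemma tendsto_one_div_atTop : Tendsto (fun τ : ℝ => 1/τ) atTop (nhds 0) := by
  simpa using tendsto_inv_atTop_zero (𝕜 := ℝ)

/-- An expansion with coefficient `F (1/τ)`, differentiable at `0`, and remainder coefficient
`G (1/τ)`, continuous at `0`, gives an expansion with coefficient `F 0`. -/
lemma expansion_of_coefficient {F G X E : ℝ → ℝ} (hF : DifferentiableAt ℝ F 0)
    (hG : ContinuousAt G 0) (hE : ∀ τ, 0 ≤ E τ)
    (h : ∀ᶠ τ in atTop, |X τ - (Real.sqrt τ)⁻¹ * F (1/τ) * E τ|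
      ≤ (Real.sqrt τ ^ 3)⁻¹ * G (1/τ) * E τ) :
    ∃ C > (0:ℝ), ∀ᶠ τ in atTop, |X τ - F 0 * τ ^ (-(1:ℝ)/2) * E τ|
      ≤ C * τ ^ (-(3:ℝ)/2) * E τ := by
  obtain ⟨c, hc, hO⟩ := hF.isBigO_sub.exists_pos
  have hO' := tendsto_one_div_atTop.eventually hO.bound
  have hG' := (hG.tendsto.comp tendsto_one_div_atTop).eventually (gt_mem_nhds (lt_add_one (G 0)))
  have hG0 : G 0 + 1 ≤ |G 0| + 1 := by linarith [le_abs_self (G 0)]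
  refine ⟨c + (|G 0| + 1), by positivity, ?_⟩
  filter_upwards [h, hO', hG', eventually_gt_atTop 0] with τ h1 h2 h3 hτ
  simp only [Real.norm_eq_abs, sub_zero, Function.comp] at h2 h3
  rw [rpow_neg_half_eq hτ, rpow_neg_three_halves_eq hτ]
  have hs : 0 < Real.sqrt τ := Real.sqrt_pos.2 hτ
  have hs2 : Real.sqrt τ ^ 2 = τ := Real.sq_sqrt hτ.le
  have hτ1 : |1/τ| = 1/τ := abs_of_pos (by positivity)
  have e1 : (Real.sqrt τ)⁻¹ * (1/τ) = (Real.sqrt τ ^ 3)⁻¹ := by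
    field_simp
    exact hs2
  have hEτ := hE τ
  have h4 : |(Real.sqrt τ)⁻¹ * F (1/τ) * E τ - F 0 * (Real.sqrt τ)⁻¹ * E τ|
      ≤ c * (Real.sqrt τ ^ 3)⁻¹ * E τ := by
    have e2 : (Real.sqrt τ)⁻¹ * F (1/τ) * E τ - F 0 * (Real.sqrt τ)⁻¹ * E τ
        = ((Real.sqrt τ)⁻¹ * E τ) * (F (1/τ) - F 0) := by ring
    rw [e2, abs_mul, abs_of_nonneg (by positivity), ← e1]
    rw [hτ1] at h2
    calc _ ≤ ((Real.sqrt τ)⁻¹ * E τ) * (c * (1/τ)) := by gcongr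
      _ = _ := by ring
  have h5 : (Real.sqrt τ ^ 3)⁻¹ * G (1/τ) * E τ ≤ (Real.sqrt τ ^ 3)⁻¹ * (|G 0| + 1) * E τ := by
    gcongr
    linarith
  calc _ ≤ _ := abs_sub_le _ ((Real.sqrt τ)⁻¹ * F (1/τ) * E τ) _
    _ ≤ (Real.sqrt τ ^ 3)⁻¹ * (|G 0| + 1) * E τ + c * (Real.sqrt τ ^ 3)⁻¹ * E τ := by linarith
    _ = _ := by ring

/-- The rescaled argument `d₊ / √τ` as a function of `u = 1/τ`. -/
def dPlus (a b k u : ℝ) : ℝ := -k / Real.sqrt (a + b*u) + Real.sqrt (a + b*u) / 2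

/-- The rescaled argument `d₋ / √τ` as a function of `u = 1/τ`. -/
def dMinus (a b k u : ℝ) : ℝ := -k / Real.sqrt (a + b*u) - Real.sqrt (a + b*u) / 2

/-- The bounded part of the exponent of the Gaussian density at `d₊`. -/
def bsExponent (a b k u : ℝ) : ℝ := k^2*b/(2*a*(a + b*u)) - b/8

/-- The call price in terms of the rescaled arguments. -/
def bsCall (a b k τ : ℝ) : ℝ :=
  Ncdf (Real.sqrt τ * dPlus a b k (1/τ))
    - Real.exp (k*τ) * Ncdf (Real.sqrt τ * dMinus a b k (1/τ))

lemma bsCall_eq {τ : ℝ} (a b k : ℝ) (hτ : 0 < τ) :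
    Ncdf (-(k*τ)/(Real.sqrt (a + b/τ)*Real.sqrt τ) + Real.sqrt (a + b/τ)*Real.sqrt τ/2)
      - Real.exp (k*τ)
        * Ncdf (-(k*τ)/(Real.sqrt (a + b/τ)*Real.sqrt τ)
            - Real.sqrt (a + b/τ)*Real.sqrt τ/2) = bsCall a b k τ := by
  have hs : 0 < Real.sqrt τ := Real.sqrt_pos.2 hτ
  have e : -(k*τ)/(Real.sqrt (a + b/τ)*Real.sqrt τ)
      = Real.sqrt τ * (-k / Real.sqrt (a + b/τ)) := by
    nth_rewrite 1 [← Real.mul_self_sqrt hτ.le]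
    rw [show -(k * (√τ * √τ)) = (√τ * -k) * √τ by ring, mul_div_mul_right _ _ hs.ne',
      mul_div_assoc]
  rw [bsCall, dPlus, dMinus, e, mul_one_div]
  congr 2
  · ring
  · congr 1
    ring

lemma eventually_vol_pos {a : ℝ} (b : ℝ) (ha : 0 < a) : ∀ᶠ τ : ℝ in atTop, 0 < a + b*(1/τ) := by
  have h : ContinuousAt (fun u : ℝ => a + b*u) 0 := by fun_prop
  exact (h.tendsto.comp tendsto_one_div_atTop).eventually (lt_mem_nhds (by simpa using ha))

lemma differentiableAt_vol {a : ℝ} (b : ℝ) (ha : 0 < a) :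
    DifferentiableAt ℝ (fun u => Real.sqrt (a + b*u)) 0 := by
  refine DifferentiableAt.sqrt (by fun_prop) ?_
  simpa using ha.ne'

lemma vol_zero_ne {a : ℝ} (b : ℝ) (ha : 0 < a) : Real.sqrt (a + b*0) ≠ 0 := by
  simpa using (Real.sqrt_pos.2 ha).ne'

lemma differentiableAt_dPlus {a : ℝ} (b k : ℝ) (ha : 0 < a) :
    DifferentiableAt ℝ (dPlus a b k) 0 :=
  ((differentiableAt_const _).div (differentiableAt_vol b ha) (vol_zero_ne b ha)).add
    ((differentiableAt_vol b ha).div_const 2)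

lemma differentiableAt_dMinus {a : ℝ} (b k : ℝ) (ha : 0 < a) :
    DifferentiableAt ℝ (dMinus a b k) 0 :=
  ((differentiableAt_const _).div (differentiableAt_vol b ha) (vol_zero_ne b ha)).sub
    ((differentiableAt_vol b ha).div_const 2)

lemma differentiableAt_bsExponent {a : ℝ} (b k : ℝ) (ha : 0 < a) :
    DifferentiableAt ℝ (bsExponent a b k) 0 := by
  refine DifferentiableAt.sub_const (DifferentiableAt.div (by fun_prop) (by fun_prop) ?_) _
  have := ha.ne'
  simpa using this

lemma dPlus_zero {a : ℝ} (b k : ℝ) (ha : 0 < a) :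
    dPlus a b k 0 = (a/2 - k) / Real.sqrt a := by
  have hs := (Real.sqrt_pos.2 ha).ne'
  rw [dPlus, mul_zero, add_zero]
  nth_rewrite 3 [← Real.mul_self_sqrt ha.le]
  field_simp
  ring

lemma dMinus_zero {a : ℝ} (b k : ℝ) (ha : 0 < a) :
    dMinus a b k 0 = (-(a/2) - k) / Real.sqrt a := by
  have hs := (Real.sqrt_pos.2 ha).ne'
  rw [dMinus, mul_zero, add_zero]
  nth_rewrite 3 [← Real.mul_self_sqrt ha.le]
  field_simp
  ring

lemma exp_dPlus {a b k τ : ℝ} (ha : 0 < a) (hτ : 0 < τ) (hv : 0 < a + b*(1/τ)) :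
    Real.exp (-((Real.sqrt τ * dPlus a b k (1/τ))^2/2))
      = Real.exp (bsExponent a b k (1/τ)) * Real.exp (-(τ*(VstarBS k a - k))) := by
  rw [← Real.exp_add]
  congr 1
  have h1 := Real.sq_sqrt hτ.le
  have h2 := Real.sq_sqrt hv.le
  have hs := Real.sqrt_pos.2 hv
  rw [mul_pow, h1, bsExponent, VstarBS, dPlus]
  set s := Real.sqrt (a + b*(1/τ))
  have hb : b = (s^2 - a) * τ := by
    rw [h2]
    field_simp
    ring
  rw [← h2, hb]
  field_simp
  ring

lemma exp_dMinus {a b k τ : ℝ} (hτ : 0 < τ) (hv : 0 < a + b*(1/τ)) :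
    Real.exp (k*τ) * Real.exp (-((Real.sqrt τ * dMinus a b k (1/τ))^2/2))
      = Real.exp (-((Real.sqrt τ * dPlus a b k (1/τ))^2/2)) := by
  rw [← Real.exp_add]
  congr 1
  have h1 := Real.sq_sqrt hτ.le
  have hs := Real.sqrt_pos.2 hv
  rw [mul_pow, mul_pow, h1, dMinus, dPlus]
  generalize Real.sqrt (a + b*(1/τ)) = s at hs
  field_simp
  ring

lemma bsCall_neg {a b k τ : ℝ} :
    bsCall a b (-k) τ = 1 - Real.exp (-(k*τ)) + Real.exp (-(k*τ)) * bsCall a b k τ := by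
  have h1 : dPlus a b (-k) (1/τ) = -dMinus a b k (1/τ) := by
    rw [dPlus, dMinus]
    ring
  have h2 : dMinus a b (-k) (1/τ) = -dPlus a b k (1/τ) := by
    rw [dPlus, dMinus]
    ring
  have h3 : Real.exp (-(k*τ)) * Real.exp (k*τ) = 1 := by
    rw [← Real.exp_add]
    simp
  rw [bsCall, bsCall, h1, h2, mul_neg, mul_neg, Ncdf_neg, Ncdf_neg, neg_mul]
  linear_combination Ncdf (√τ * dMinus a b k (1 / τ)) * h3

/-- Expansion of the call price when neither argument vanishes in the limit. -/
lemma bsCall_expansion_of_ne {a : ℝ} (b : ℝ) {k : ℝ} (ha : 0 < a) (h1 : k ≠ a/2)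
    (h2 : k ≠ -(a/2)) :
    ∃ C > (0:ℝ), ∀ᶠ τ in atTop,
      |bsCall a b k τ - II k τ (-(a/2)) (a/2) 0
          - phiBS k a b * τ ^ (-(1:ℝ)/2) * Real.exp (-(τ*(VstarBS k a - k)))|
        ≤ C * τ ^ (-(3:ℝ)/2) * Real.exp (-(τ*(VstarBS k a - k))) := by
  have hsa := Real.sqrt_pos.2 ha
  have hP0 : dPlus a b k 0 ≠ 0 := by
    rw [dPlus_zero b k ha]
    exact div_ne_zero (sub_ne_zero.2 h1.symm) hsa.ne'
  have hQ0 : dMinus a b k 0 ≠ 0 := by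
    rw [dMinus_zero b k ha]
    exact div_ne_zero (sub_ne_zero.2 h2.symm) hsa.ne'
  have hP := differentiableAt_dPlus b k ha
  have hQ := differentiableAt_dMinus b k ha
  have hR := differentiableAt_bsExponent b k ha
  set c := (Real.sqrt (2*Real.pi))⁻¹ with hc
  let F : ℝ → ℝ := fun u => -(c * Real.exp (bsExponent a b k u)
    * (1 / dPlus a b k u - 1 / dMinus a b k u))
  let G : ℝ → ℝ := fun u => c * Real.exp (bsExponent a b k u)
    * (1 / |dPlus a b k u|^3 + 1 / |dMinus a b k u|^3)
  have hF : DifferentiableAt ℝ F 0 :=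
    ((hR.exp.const_mul c).mul (((differentiableAt_const _).div hP hP0).sub
      ((differentiableAt_const _).div hQ hQ0))).neg
  have hG : ContinuousAt G 0 :=
    (hR.exp.const_mul c).continuousAt.mul
      ((continuousAt_const.div (hP.continuousAt.abs.pow 3) (pow_ne_zero 3 (abs_ne_zero.2 hP0))).add
        (continuousAt_const.div (hQ.continuousAt.abs.pow 3) (pow_ne_zero 3 (abs_ne_zero.2 hQ0))))
  have hF0 : F 0 = phiBS k a b := by
    simp only [F]
    rw [phiBS, if_pos ⟨h1, h2⟩, dPlus_zero b k ha, dMinus_zero b k ha,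
      rpow_three_halves_eq ha.le, bsExponent, hc]
    have e : k^2*b/(2*a*(a + b*0)) - b/8 = b*(k^2/(2*a^2) - 1/8) := by
      rw [mul_zero, add_zero]
      field_simp
    have n1 : a/2 - k ≠ 0 := sub_ne_zero.2 h1.symm
    have n2 : -(a/2) - k ≠ 0 := sub_ne_zero.2 h2.symm
    have n3 : 4*k^2 - a^2 ≠ 0 := by
      have : 4*k^2 - a^2 = 4 * ((a/2 - k) * (-(a/2) - k)) := by ring
      rw [this]
      exact mul_ne_zero four_ne_zero (mul_ne_zero n1 n2)
    have e2 : 1 / ((a/2 - k) / Real.sqrt a) - 1 / ((-(a/2) - k) / Real.sqrt a)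
        = -(4 * Real.sqrt a ^ 3 / (4*k^2 - a^2)) := by
      rw [one_div_div, one_div_div, div_sub_div _ _ n1 n2, ← neg_div (4*k^2 - a^2),
        div_eq_div_iff (mul_ne_zero n1 n2) n3,
        show Real.sqrt a ^ 3 = Real.sqrt a ^ 2 * Real.sqrt a by ring, Real.sq_sqrt ha.le]
      ring
    rw [e, e2]
    have : Real.sqrt (2*Real.pi) ≠ 0 := by positivity
    field_simp
  rw [← hF0]
  refine expansion_of_coefficient hF hG (fun τ => (Real.exp_pos _).le) ?_
  have sgn : ∀ {f : ℝ → ℝ}, DifferentiableAt ℝ f 0 → f 0 ≠ 0 →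
      ∀ᶠ τ in atTop, f (1/τ) ≠ 0 ∧ (0 < f (1/τ) ↔ 0 < f 0) := by
    intro f hf hf0
    have ht := hf.continuousAt.tendsto.comp tendsto_one_div_atTop
    rcases hf0.lt_or_gt with h | h
    · filter_upwards [ht.eventually (gt_mem_nhds h)] with τ hτ
      exact ⟨hτ.ne, iff_of_false (not_lt.2 hτ.le) (not_lt.2 h.le)⟩
    · filter_upwards [ht.eventually (lt_mem_nhds h)] with τ hτ
      exact ⟨hτ.ne', iff_of_true hτ h⟩
  filter_upwards [sgn hP hP0, sgn hQ hQ0, eventually_vol_pos b ha, eventually_gt_atTop 0]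
    with τ ⟨hp, hp'⟩ ⟨hq, hq'⟩ hv hτ
  have hs : 0 < Real.sqrt τ := Real.sqrt_pos.2 hτ
  have eP : 0 < Real.sqrt τ * dPlus a b k (1/τ) ↔ k < a/2 := by
    rw [mul_pos_iff_of_pos_left hs, hp', dPlus_zero b k ha, div_pos_iff_of_pos_right hsa, sub_pos]
  have eQ : 0 < Real.sqrt τ * dMinus a b k (1/τ) ↔ k < -(a/2) := by
    rw [mul_pos_iff_of_pos_left hs, hq', dMinus_zero b k ha, div_pos_iff_of_pos_right hsa, sub_pos]
  have tP := Ncdf_tail (mul_ne_zero hs.ne' hp)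
  have tQ := Ncdf_tail (mul_ne_zero hs.ne' hq)
  have mP := exp_dPlus (k := k) ha hτ hv
  have mQ := exp_dMinus (k := k) hτ hv
  rw [mP] at mQ
  rw [mP, if_congr eP rfl rfl] at tP
  rw [if_congr eQ rfl rfl] at tQ
  replace tQ := mul_le_mul_of_nonneg_left tQ (Real.exp_pos (k*τ)).le
  rw [← abs_of_pos (Real.exp_pos (k*τ)), ← abs_mul, abs_of_pos (Real.exp_pos (k*τ))] at tQ
  have hII : II k τ (-(a/2)) (a/2) 0 = (if k < a/2 then 1 else 0)
      - Real.exp (k*τ) * (if k < -(a/2) then 1 else 0) := by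
    rw [II, if_neg h1, if_neg h2]
    rcases h1.lt_or_gt with l1 | l1
    · rcases h2.lt_or_gt with l2 | l2
      · simp [l1, l2, l2.not_gt]
      · simp [l1, l2, l2.not_gt]
    · have l2 : -(a/2) < k := by linarith
      simp [l1.not_gt, l2.not_gt]
  rw [hII]
  set E := Real.exp (-(τ*(VstarBS k a - k)))
  set M := Real.exp (bsExponent a b k (1/τ)) with hM
  set t := Real.sqrt τ
  refine (le_of_eq ?_).trans ((abs_sub _ _).trans (add_le_add tP tQ) |>.trans (le_of_eq ?_))
  · congr 1
    simp only [F, bsCall, ← hM]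
    linear_combination (c / (t * dMinus a b k (1/τ))) * mQ
  · simp only [G, ← hM]
    rw [abs_mul, abs_mul, abs_of_pos hs]
    linear_combination (c / (t * |dMinus a b k (1/τ)|)^3) * mQ

/-- Expansion of the call price at the boundary value `k = a/2`. -/
lemma bsCall_expansion_half {a : ℝ} (b : ℝ) (ha : 0 < a) :
    ∃ C > (0:ℝ), ∀ᶠ τ in atTop,
      |bsCall a b (a/2) τ - 1/2 - (b - 2) / (2*Real.sqrt (2*a*Real.pi)) * τ ^ (-(1:ℝ)/2)|
        ≤ C * τ ^ (-(3:ℝ)/2) := by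
  have hsa := Real.sqrt_pos.2 ha
  have hQ0' : dMinus a b (a/2) 0 = -Real.sqrt a := by
    rw [dMinus_zero b _ ha, div_eq_iff hsa.ne']
    linear_combination Real.mul_self_sqrt ha.le
  have hQ0 : dMinus a b (a/2) 0 ≠ 0 := by
    rw [hQ0']
    exact neg_ne_zero.2 hsa.ne'
  have hV := differentiableAt_vol b ha
  have hQ := differentiableAt_dMinus b (a/2) ha
  have hR := differentiableAt_bsExponent b (a/2) ha
  set c := (Real.sqrt (2*Real.pi))⁻¹ with hc
  let W : ℝ → ℝ := fun u => b / (2 * Real.sqrt (a + b*u))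
  have hW : DifferentiableAt ℝ W 0 :=
    (differentiableAt_const _).div (hV.const_mul 2) (mul_ne_zero two_ne_zero (vol_zero_ne b ha))
  let F : ℝ → ℝ := fun u =>
    c * (W u + Real.exp (bsExponent a b (a/2) u) / dMinus a b (a/2) u)
  let G : ℝ → ℝ := fun u =>
    c * (|W u|^3 + Real.exp (bsExponent a b (a/2) u) / |dMinus a b (a/2) u|^3)
  have hF : DifferentiableAt ℝ F 0 := (hW.add (hR.exp.div hQ hQ0)).const_mul c
  have hG : ContinuousAt G 0 :=
    continuousAt_const.mul ((hW.continuousAt.abs.pow 3).add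
      (hR.exp.continuousAt.div (hQ.continuousAt.abs.pow 3) (by positivity)))
  have hF0 : F 0 = (b - 2) / (2*Real.sqrt (2*a*Real.pi)) := by
    have e : bsExponent a b (a/2) 0 = 0 := by
      rw [bsExponent, mul_zero, add_zero]
      field_simp
      ring
    have e2 : Real.sqrt (2*a*Real.pi) = Real.sqrt (2*Real.pi) * Real.sqrt a := by
      rw [← Real.sqrt_mul (by positivity)]
      congr 1
      ring
    have h2p : Real.sqrt (2*Real.pi) ≠ 0 := by positivity
    simp only [F, W]
    rw [e, e2, hQ0', Real.exp_zero, hc, mul_zero, add_zero]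
    generalize Real.sqrt (2*Real.pi) = q at h2p
    field_simp
    ring
  have key := expansion_of_coefficient (X := fun τ => bsCall a b (a/2) τ - 1/2)
    (E := fun _ => 1) hF hG (fun _ => zero_le_one) ?_
  · simpa only [hF0, mul_one] using key
  have ht := hQ.continuousAt.tendsto.comp tendsto_one_div_atTop
  rw [hQ0'] at ht
  filter_upwards [ht.eventually (gt_mem_nhds (neg_neg_of_pos hsa)), eventually_vol_pos b ha,
    eventually_gt_atTop 0] with τ hq hv hτ
  simp only [Function.comp] at hq
  have hs : 0 < Real.sqrt τ := Real.sqrt_pos.2 hτ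
  have hp : Real.sqrt τ * dPlus a b (a/2) (1/τ) = (Real.sqrt τ)⁻¹ * W (1/τ) := by
    have h1 := Real.sq_sqrt hτ.le
    have h2 := Real.sq_sqrt hv.le
    have hv' := Real.sqrt_pos.2 hv
    simp only [W]
    rw [dPlus]
    set s := Real.sqrt (a + b*(1/τ))
    have hb : b = (s^2 - a) * Real.sqrt τ ^ 2 := by
      rw [h2, h1]
      field_simp
      ring
    rw [hb]
    field_simp
    ring
  have tP := Ncdf_near_zero (Real.sqrt τ * dPlus a b (a/2) (1/τ))
  have tQ := Ncdf_tail (mul_ne_zero hs.ne' hq.ne)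
  have mP := exp_dPlus (k := a/2) ha hτ hv
  have mQ := exp_dMinus (k := a/2) hτ hv
  have hE : τ * (VstarBS (a/2) a - a/2) = 0 := by
    rw [VstarBS]
    field_simp
    ring
  rw [mP, hE, neg_zero, Real.exp_zero, mul_one] at mQ
  rw [hp] at tP
  rw [if_neg (mul_neg_of_pos_of_neg hs hq).not_gt] at tQ
  replace tQ := mul_le_mul_of_nonneg_left tQ (Real.exp_pos (a/2*τ)).le
  rw [← abs_of_pos (Real.exp_pos (a/2*τ)), ← abs_mul,
    abs_of_pos (Real.exp_pos (a/2*τ))] at tQ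
  refine (le_of_eq ?_).trans ((abs_sub _ _).trans (add_le_add tP tQ) |>.trans (le_of_eq ?_))
  · congr 1
    simp only [F, bsCall]
    rw [hp]
    linear_combination (c / (Real.sqrt τ * dMinus a b (a/2) (1/τ))) * mQ
  · simp only [G]
    rw [abs_mul, abs_mul, abs_of_pos hs, abs_of_pos (inv_pos.2 hs)]
    linear_combination (c / (Real.sqrt τ * |dMinus a b (a/2) (1/τ)|)^3) * mQ

/-- Expansion of the call price for every log-moneyness slope `k`. -/
lemma bsCall_expansion {a : ℝ} (b k : ℝ) (ha : 0 < a) :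
    ∃ C > (0:ℝ), ∀ᶠ τ in atTop,
      |bsCall a b k τ - II k τ (-(a/2)) (a/2) 0
          - phiBS k a b * τ ^ (-(1:ℝ)/2) * Real.exp (-(τ*(VstarBS k a - k)))|
        ≤ C * τ ^ (-(3:ℝ)/2) * Real.exp (-(τ*(VstarBS k a - k))) := by
  by_cases h1 : k = a/2
  · subst h1
    obtain ⟨C, hC, h⟩ := bsCall_expansion_half b ha
    refine ⟨C, hC, h.mono fun τ hτ => ?_⟩
    have hE : τ * (VstarBS (a/2) a - a/2) = 0 := by
      rw [VstarBS]
      field_simp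
      ring
    have hne : a/2 ≠ -(a/2) := by linarith
    have hlt : ¬ a/2 < -(a/2) := by linarith
    have hII : II (a/2) τ (-(a/2)) (a/2) 0 = 1/2 := by
      simp [II, hne, hlt]
    rw [hE, hII, phiBS, if_neg (by simp)]
    simpa using hτ
  by_cases h2 : k = -(a/2)
  · subst h2
    obtain ⟨C, hC, h⟩ := bsCall_expansion_half b ha
    refine ⟨C, hC, h.mono fun τ hτ => ?_⟩
    have hE : -(τ * (VstarBS (-(a/2)) a - -(a/2))) = -(a/2*τ) := by
      rw [VstarBS]
      field_simp
      ring
    have hlt : ¬ a/2 < -(a/2) := by linarith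
    have hII : II (-(a/2)) τ (-(a/2)) (a/2) 0 = 1 - Real.exp (-(a/2*τ))/2 := by
      simp [II, hlt, h1]
    rw [hE, hII, phiBS, if_neg (by simp), bsCall_neg]
    have h3 := mul_le_mul_of_nonneg_left hτ (Real.exp_pos (-(a/2*τ))).le
    rw [← abs_of_pos (Real.exp_pos (-(a/2*τ))), ← abs_mul,
      abs_of_pos (Real.exp_pos (-(a/2*τ)))] at h3
    refine (le_of_eq ?_).trans (h3.trans (le_of_eq ?_))
    · congr 1
      ring
    · ring
  exact bsCall_expansion_of_ne b ha h1 h2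

theorem stmt18 (a b k : ℝ) (ha : 0 < a) :
    ∃ C > (0:ℝ), ∃ τ₀ > (0:ℝ), ∀ τ > τ₀,
      0 < a + b/τ ∧
      |(Ncdf (-(k*τ)/(Real.sqrt (a + b/τ)*Real.sqrt τ) + Real.sqrt (a + b/τ)*Real.sqrt τ/2)
          - Real.exp (k*τ)
            * Ncdf (-(k*τ)/(Real.sqrt (a + b/τ)*Real.sqrt τ)
                - Real.sqrt (a + b/τ)*Real.sqrt τ/2))
        - II k τ (-(a/2)) (a/2) 0
        - phiBS k a b * τ ^ (-(1:ℝ)/2) * Real.exp (-(τ*(VstarBS k a - k)))|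
      ≤ C * τ ^ (-(3:ℝ)/2) * Real.exp (-(τ*(VstarBS k a - k))) := by
  obtain ⟨C, hC, h⟩ := bsCall_expansion b k ha
  obtain ⟨T, hT⟩ := eventually_atTop.1 (h.and (eventually_vol_pos b ha))
  refine ⟨C, hC, max T 1, by positivity, fun τ hτ => ?_⟩
  have hτ0 : 0 < τ := lt_trans (by positivity) hτ
  obtain ⟨h1, h2⟩ := hT τ ((le_max_left T 1).trans hτ.le)
  rw [bsCall_eq a b k hτ0]
  exact ⟨by simpa [div_eq_mul_inv] using h2, h1⟩

end
end
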